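/- Let w₀ ∈ ℂ and α, β ∈ ℝ, and let A = {w₀·e^{(α+iβ)t} : t ∈ [0,+∞)} be the trace of the spiral curve γ(t) = w₀·e^{(α+iβ)t}. Then A is Ahlfors regular: there exists a constant C > 0 such that for every w ∈ ℂ and every r > 0, the one-dimensional Hausdorff measure of A ∩ {ζ ∈ ℂ : |ζ − w| < r} is at most C·r. -/

import Mathlib

open Complex Set Metric Filter MeasureTheory

/-- A set covered by a `K`-Lipschitz image of a subset of `[a, b]` has length at most
`K * (b - a)`. -/
theorem hausdorffMeasure_one_le_of_subset_lipschitz_image {X : Type*} [MetricSpace X]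
    [MeasurableSpace X] [BorelSpace X] {f : ℝ → X} {K : NNReal} {s : Set ℝ} {S : Set X} {a b : ℝ}
    (hf : LipschitzOnWith K f s) (hS : S ⊆ f '' s) (hs : s ⊆ Icc a b) :
    (μH[1] : Measure X) S ≤ ENNReal.ofReal (K * (b - a)) := by
  calc (μH[1] : Measure X) S ≤ μH[1] (f '' s) := measure_mono hS
    _ ≤ (K : ENNReal) ^ (1 : ℝ) * μH[1] s := hf.hausdorffMeasure_image_le zero_le_one
    _ = K * volume s := by rw [ENNReal.rpow_one, hausdorffMeasure_real]
    _ ≤ K * volume (Icc a b) := by gcongr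
    _ = ENNReal.ofReal (K * (b - a)) := by
      rw [Real.volume_Icc, ENNReal.ofReal_mul K.coe_nonneg, ENNReal.ofReal_coe_nnreal]

/-- The part of a circle centred at the origin lying in a ball of radius `r` has length at most
`2 * π * r`. -/
theorem hausdorffMeasure_one_sphere_inter_ball_le {R : ℝ} (hR : 0 < R) (w : ℂ) (r : ℝ) :
    (μH[1] : Measure ℂ) (sphere 0 R ∩ ball w r) ≤ ENNReal.ofReal (2 * Real.pi * r) := by
  rcases (sphere (0 : ℂ) R ∩ ball w r).eq_empty_or_nonempty with h | ⟨p, hpR, hpr⟩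
  · simp [h]
  rw [mem_sphere_zero_iff_norm] at hpR
  have hp0 : p ≠ 0 := norm_pos_iff.1 (hpR ▸ hR)
  have hlip : LipschitzOnWith ‖p‖₊ (fun θ : ℝ ↦ p * exp (θ * I))
      (Icc (-(Real.pi * r / R)) (Real.pi * r / R)) := by
    refine (convex_Icc _ _).lipschitzOnWith_of_nnnorm_hasDerivWithin_le
      (f' := fun θ : ℝ ↦ p * (exp (θ * I) * (1 * I))) (fun θ _ ↦ ?_) (fun θ _ ↦ ?_)
    · exact ((((hasDerivAt_id (θ : ℂ)).comp_ofReal.mul_const I).cexp).const_mul p).hasDerivWithinAt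
    · rw [← NNReal.coe_le_coe]
      simp
  refine (hausdorffMeasure_one_le_of_subset_lipschitz_image hlip ?_ subset_rfl).trans_eq ?_
  · rintro q ⟨hqR, hqr⟩
    rw [mem_sphere_zero_iff_norm] at hqR
    have hq0 : q ≠ 0 := norm_pos_iff.1 (hqR ▸ hR)
    refine ⟨(q / p).arg, ?_, ?_⟩
    · have hqp : ‖q - p‖ ≤ 2 * r := by
        rw [← dist_eq_norm]
        rw [mem_ball] at hpr hqr
        linarith [dist_triangle_right q p w]
      have hangle := angle_le_mul_norm_sub (x := q / R) (y := p / R)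
        (by simp [hqR, abs_of_pos hR, hR.ne']) (by simp [hpR, abs_of_pos hR, hR.ne'])
      have hRC : (R : ℂ) ≠ 0 := by exact_mod_cast hR.ne'
      rw [angle_eq_abs_arg (by positivity) (by positivity), div_div_div_cancel_right₀ hRC,
        ← sub_div, norm_div, norm_real, Real.norm_of_nonneg hR.le] at hangle
      rw [mem_Icc, ← abs_le]
      refine hangle.trans ?_
      rw [div_mul_div_comm, div_le_div_iff₀ (by positivity) hR]
      nlinarith [mul_le_mul_of_nonneg_left hqp (mul_pos Real.pi_pos hR).le]
    · have h := norm_mul_exp_arg_mul_I (q / p)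
      rw [norm_div, hqR, hpR, div_self hR.ne', ofReal_one, one_mul] at h
      simp only [h]
      field_simp
  · congr 1
    rw [coe_nnnorm, hpR]
    field_simp
    ring

/-- The trace `A = {w₀·e^{(α+iβ)t} : t ≥ 0}` of a spiral curve is Ahlfors regular:
there is `C > 0` such that for every `w ∈ ℂ` and `r > 0`, the one-dimensional Hausdorff
measure of `A ∩ {ζ : |ζ − w| < r}` is at most `C·r`. -/
theorem spiral_ahlfors_regular (w₀ : ℂ) (α β : ℝ) :
    ∃ C > 0, ∀ w : ℂ, ∀ r : ℝ, 0 < r →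
      (μH[1] : Measure ℂ)
        ({ζ : ℂ | ∃ t : ℝ, 0 ≤ t ∧ ζ = w₀ * Complex.exp ((α + β * Complex.I) * t)} ∩
          Metric.ball w r) ≤ ENNReal.ofReal (C * r) := by
  rcases eq_or_ne w₀ 0 with rfl | hw₀
  · refine ⟨1, one_pos, fun w r _ ↦ ?_⟩
    have hsub : {ζ : ℂ | ∃ t : ℝ, 0 ≤ t ∧ ζ = 0 * exp ((α + β * I) * t)} ∩ ball w r ⊆ {0} := by
      rintro ζ ⟨⟨t, -, rfl⟩, -⟩
      simp
    have := Measure.nullSingletonClass_hausdorff ℂ one_pos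
    rw [measure_mono_null hsub (measure_singleton 0)]
    exact zero_le
  have hn : 0 < ‖w₀‖ := norm_pos_iff.2 hw₀
  have hnorm (t : ℝ) : ‖w₀ * exp ((α + β * I) * t)‖ = ‖w₀‖ * Real.exp (α * t) := by
    simp [norm_exp]
  rcases eq_or_ne α 0 with rfl | hα
  · refine ⟨2 * Real.pi, by positivity, fun w r _ ↦ ?_⟩
    refine (measure_mono (inter_subset_inter_left _ ?_)).trans
      (hausdorffMeasure_one_sphere_inter_ball_le hn w r)
    rintro ζ ⟨t, -, rfl⟩
    rw [mem_sphere_zero_iff_norm, hnorm]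
    simp
  have hc : (α + β * I : ℂ) ≠ 0 := fun h ↦ hα (by simpa using congrArg re h)
  set K : NNReal := ‖(α + β * I : ℂ)‖₊ / ‖α‖₊ with hK
  have hK0 : 0 < K := div_pos (nnnorm_pos.2 hc) (nnnorm_pos.2 hα)
  -- The spiral, reparametrized by the distance to the origin.
  set f : ℝ → ℂ := fun ρ ↦ w₀ * exp ((α + β * I) * ((Real.log (ρ / ‖w₀‖) / α : ℝ) : ℂ)) with hf
  have hlip : LipschitzOnWith K f (Ioi 0) := by
    refine (convex_Ioi 0).lipschitzOnWith_of_nnnorm_hasDerivWithin_le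
      (f' := fun ρ : ℝ ↦ w₀ * (exp ((α + β * I) * ((Real.log (ρ / ‖w₀‖) / α : ℝ) : ℂ)) *
        ((α + β * I) * ((1 / ‖w₀‖ / (ρ / ‖w₀‖) / α : ℝ) : ℂ)))) (fun ρ hρ ↦ ?_) (fun ρ hρ ↦ ?_)
    · have hρ' : ρ / ‖w₀‖ ≠ 0 := (div_pos hρ hn).ne'
      exact ((((((hasDerivAt_id ρ).div_const ‖w₀‖).log hρ').div_const α).ofReal_comp.const_mul
        (α + β * I : ℂ)).cexp.const_mul w₀).hasDerivWithinAt
    · have hρ0 : 0 < ρ := hρ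
      rw [← NNReal.coe_le_coe, coe_nnnorm, ← mul_assoc, norm_mul, hnorm, mul_div_cancel₀ _ hα,
        Real.exp_log (div_pos hρ hn), norm_mul, norm_real, hK, NNReal.coe_div, coe_nnnorm,
        coe_nnnorm, norm_div, Real.norm_of_nonneg (by positivity : 0 ≤ 1 / ‖w₀‖ / (ρ / ‖w₀‖))]
      apply le_of_eq
      field_simp
  refine ⟨2 * K, by positivity, fun w r _ ↦ ?_⟩
  refine (hausdorffMeasure_one_le_of_subset_lipschitz_image
    (s := Ioi 0 ∩ Icc (‖w‖ - r) (‖w‖ + r)) (hlip.mono inter_subset_left) ?_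
    inter_subset_right).trans_eq (by congr 1; ring)
  rintro ζ ⟨⟨t, -, rfl⟩, hζ⟩
  refine ⟨‖w₀ * exp ((α + β * I) * t)‖, ⟨?_, ?_⟩, ?_⟩
  · rw [hnorm]
    exact mul_pos hn (Real.exp_pos _)
  · rw [mem_ball, dist_eq_norm] at hζ
    have := (abs_le.1 ((abs_norm_sub_norm_le _ _).trans hζ.le))
    exact ⟨by linarith, by linarith⟩
  · simp only [hf]
    rw [hnorm, mul_div_cancel_left₀ _ hn.ne', Real.log_exp, mul_div_cancel_left₀ _ hα]
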